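/- arXiv:2205.04729 — 3 statements merged into one kernel-verified Lean document; each statement's English description precedes it below -/
import Mathlib

section
/- Let (C^•, d) be a cochain complex of modules over a commutative ring with a finite decreasing filtration F by subcomplexes, and suppose the differential d is strict with respect to F, i.e. d(C^{i}) ∩ F^p C^{i+1} = d(F^p C^{i}) for all i and p. Then: (a) for every i and every k, the natural map H^i(C^•) → H^i(C^•/F^{k+1}C^•) is surjective; and (b) the differential of the quotient complex C^•/F^{k+1}C^• is strict with respect to the induced filtration. -/
/-!
Statement 3: Let `(C^•, d)` be a cochain complex of modules over a commutative ring
with a finite decreasing filtration `F` by subcomplexes (`F^0 C = C`, `F^N C = 0`),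
and suppose `d` is strict with respect to `F`, i.e.
`d(C^i) ∩ F^p C^{i+1} = d(F^p C^i)` for all `i, p`.  Then for every `k`:

(a) the natural map `H^i(C^•) → H^i(C^•/F^{k+1}C^•)` is surjective for every `i`;

(b) the differential of `C^•/F^{k+1}C^•` is strict with respect to the induced filtration.

Both conclusions are expressed elementwise.  For (a): every cocycle of the quotient
complex (an `x : C^{i+1}` with `d x ∈ F^{k+1} C^{i+2}`) agrees, modulo
`F^{k+1} C^{i+1}` and a boundary `d w`, with an honest cocycle `y`.
For (b): the induced filtration on the quotient is `F̄^p = (F^p + F^{k+1})/F^{k+1}`, so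
`d̄ x̄ ∈ F̄^p` means `d x ∈ F^p + F^{k+1}`, and strictness of `d̄` means that then
`d x ≡ d w (mod F^{k+1})` for some `w ∈ F^p`.
-/

theorem statement3 {R : Type*} [CommRing R] (C : ℤ → Type*)
    [∀ i, AddCommGroup (C i)] [∀ i, Module R (C i)]
    (d : ∀ i, C i →ₗ[R] C (i + 1))
    (hdd : ∀ i (x : C i), d (i + 1) (d i x) = 0)
    (F : ℕ → ∀ i, Submodule R (C i))
    (hFdec : ∀ p i, F (p + 1) i ≤ F p i)
    (hF0 : ∀ i, F 0 i = ⊤)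
    (N : ℕ) (hFN : ∀ i, F N i = ⊥)
    (hdF : ∀ p i, ∀ x ∈ F p i, d i x ∈ F p (i + 1))
    (hstrict : ∀ p i (x : C i), d i x ∈ F p (i + 1) → ∃ y ∈ F p i, d i y = d i x)
    (k : ℕ) :
    -- (a) surjectivity of H^{i+1}(C) → H^{i+1}(C/F^{k+1}C) for all degrees
    (∀ i (x : C (i + 1)), d (i + 1) x ∈ F (k + 1) (i + 1 + 1) →
      ∃ (y : C (i + 1)) (w : C i),
        d (i + 1) y = 0 ∧ x - y - d i w ∈ F (k + 1) (i + 1)) ∧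
    -- (b) strictness of the induced differential on C/F^{k+1}C
    (∀ p i (x : C i), d i x ∈ F p (i + 1) ⊔ F (k + 1) (i + 1) →
      ∃ w ∈ F p i, d i x - d i w ∈ F (k + 1) (i + 1)) := by
  have hanti : ∀ j, Antitone fun p => F p j := fun j =>
    antitone_nat_of_succ_le fun p => hFdec p j
  refine ⟨fun i x hx => ?_, fun p i x hx => ?_⟩
  · obtain ⟨z, hz, hdz⟩ := hstrict (k + 1) (i + 1) x hx
    refine ⟨x - z, 0, ?_, ?_⟩
    · rw [map_sub, hdz, sub_self]
    · simpa using hz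
  · rcases le_total p (k + 1) with hp | hp
    · rw [sup_eq_left.mpr (hanti (i + 1) hp)] at hx
      obtain ⟨w, hw, hdw⟩ := hstrict p i x hx
      exact ⟨w, hw, by simp [hdw]⟩
    · rw [sup_eq_right.mpr (hanti (i + 1) hp)] at hx
      exact ⟨0, zero_mem _, by simpa using hx⟩
end

section
/- Let B be a ℂ-algebra, f ∈ B a non-zerodivisor, B̄ = B/(f), and k ≥ 1 an integer. Assume: (a) for every 1 ≤ p ≤ k+1 the map Ω^{p−1}_B/(df ∧ Ω^{p−2}_B) → Ω^p_B induced by ω ↦ df ∧ ω is injective; and (b) Ω^p_B has no f-torsion for every 2 ≤ p ≤ k+1. Then for every 1 ≤ p ≤ k: Tor₁^B(Ω^p_B/(df ∧ Ω^{p−1}_B), B̄) = 0, and the sequence 0 → Ω^{p−1}_{B̄} → Ω^p_B ⊗_B B̄ → Ω^p_{B̄} → 0 is exact, where the first map is induced by lifting a form to B and wedging with df, and the second map is the canonical surjection. -/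
set_option synthInstance.maxHeartbeats 1000000
set_option maxHeartbeats 1000000

/-!
Statement 9: Let `B` be a `ℂ`-algebra, `f ∈ B` a non-zerodivisor, `B̄ = B/(f)`, `k ≥ 1`.
Assume (a) for every `1 ≤ p ≤ k+1` the map `Ω^{p−1}_B/(df ∧ Ω^{p−2}_B) → Ω^p_B` induced by
`ω ↦ df ∧ ω` is injective, and (b) `Ω^p_B` has no `f`-torsion for `2 ≤ p ≤ k+1`.
Then for every `1 ≤ p ≤ k`: `Tor₁^B(Ω^p_B/(df ∧ Ω^{p−1}_B), B̄) = 0`, and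
`0 → Ω^{p−1}_{B̄} → Ω^p_B ⊗_B B̄ → Ω^p_{B̄} → 0` is exact, where the first map is induced
by lifting a form to `B` and wedging with `df`, and the second is the canonical surjection.

Here `Ω^p_B = ⋀[B]^p Ω[B⁄ℂ]` is realised as a submodule of the exterior algebra of the
Kähler differentials, `df ∧ ·` is the linear map `wedgeD`, and the two maps in the exact
sequence are characterised by their (defining) values on the standard generators
`d b̄₁ ∧ ⋯ ∧ d b̄_p` (resp. `(d b₁ ∧ ⋯ ∧ d b_p) ⊗ 1`).
-/

open TensorProduct

universe u

section Stmt9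

variable (B : Type u) [CommRing B] [Algebra ℂ B] (f : B)

/-- `B̄ = B/(f)`. -/
abbrev Stmt9.Bbar : Type u := B ⧸ Ideal.span {f}

/-- The wedge product map `df ∧ · : Ω^q_B → Ω^{q+1}_B` on exterior powers of the module
of Kähler differentials, realised inside the exterior algebra. -/
noncomputable def Stmt9.wedgeD (q : ℕ) :
    ↥(⋀[B]^q (Ω[B⁄ℂ])) →ₗ[B] ↥(⋀[B]^(q + 1) (Ω[B⁄ℂ])) :=
  LinearMap.codRestrict _
    ((LinearMap.mulLeft B (ExteriorAlgebra.ι B (KaehlerDifferential.D ℂ B f))).comp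
      (Submodule.subtype _))
    (fun x => by
      show ExteriorAlgebra.ι B (KaehlerDifferential.D ℂ B f) * (x : ExteriorAlgebra B (Ω[B⁄ℂ])) ∈
        (LinearMap.range (ExteriorAlgebra.ι B : Ω[B⁄ℂ] →ₗ[B] ExteriorAlgebra B (Ω[B⁄ℂ]))) ^ (q + 1)
      rw [pow_succ']
      exact Submodule.mul_mem_mul (LinearMap.mem_range_self _ _) x.2)

end Stmt9

section Tor

open CategoryTheory CategoryTheory.Limits

variable {C : Type*} [Category* C] [Abelian C]

theorem down_nat_rel_one_zero : (ComplexShape.down ℕ).Rel 1 0 := ComplexShape.down_mk 1 0 rfl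

/-- A short exact sequence `0 ⟶ P₁ ⟶ P₀ ⟶ Z ⟶ 0` with `P₁`, `P₀` projective is a projective
resolution of `Z`. -/
noncomputable def CategoryTheory.ShortComplex.ShortExact.projectiveResolution
    {S : ShortComplex C} (hS : S.ShortExact) [Projective S.X₁] [Projective S.X₂] :
    ProjectiveResolution S.X₃ where
  complex := HomologicalComplex.double S.f down_nat_rel_one_zero
  projective n := by
    match n with
    | 0 => exact Projective.of_iso (HomologicalComplex.doubleXIso₁ S.f _ one_ne_zero).symm ‹_›
    | 1 => exact Projective.of_iso (HomologicalComplex.doubleXIso₀ S.f _).symm ‹_›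
    | n + 2 =>
      exact Projective.of_iso (HomologicalComplex.isZero_double_X S.f _ _ (by simp)
        (by simp)).isoZero.symm inferInstance
  π := (ChainComplex.toSingle₀Equiv _ _).symm
    ⟨(HomologicalComplex.doubleXIso₁ S.f _ one_ne_zero).hom ≫ S.g, by
      simp [HomologicalComplex.double_d S.f down_nat_rel_one_zero one_ne_zero]⟩
  quasiIso := ⟨fun n => by
    have := hS.mono_f
    match n with
    | 0 =>
      rw [ChainComplex.quasiIsoAt₀_iff, ShortComplex.quasiIso_iff_of_zeros' _
        (HomologicalComplex.double_d_eq_zero₀ S.f down_nat_rel_one_zero _ _ zero_ne_one) rfl rfl]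
      have comm : (HomologicalComplex.doubleXIso₀ S.f down_nat_rel_one_zero).hom ≫ S.f =
          (HomologicalComplex.double S.f down_nat_rel_one_zero).d 1 0 ≫
            (HomologicalComplex.doubleXIso₁ S.f down_nat_rel_one_zero one_ne_zero).hom := by
        simp [HomologicalComplex.double_d S.f down_nat_rel_one_zero one_ne_zero]
      refine (ShortComplex.exact_and_epi_g_iff_of_iso ?_).2 ⟨hS.exact, hS.epi_g⟩
      refine ShortComplex.isoMk (HomologicalComplex.doubleXIso₀ S.f down_nat_rel_one_zero)
          (HomologicalComplex.doubleXIso₁ S.f down_nat_rel_one_zero one_ne_zero) (Iso.refl _)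
          comm ?_
      refine Eq.trans ?_ (Category.comp_id _).symm
      exact (ChainComplex.toSingle₀Equiv_symm_apply_f_zero (V := C)
        (C := HomologicalComplex.double S.f down_nat_rel_one_zero) _ _).symm
    | 1 =>
      rw [quasiIsoAt_iff_exactAt' (hL := ChainComplex.exactAt_succ_single_obj ..),
        HomologicalComplex.exactAt_iff' _ 2 1 0 (by simp) (by simp),
        ShortComplex.exact_iff_mono]
      · change Mono ((HomologicalComplex.double S.f down_nat_rel_one_zero).d 1 0)
        rw [HomologicalComplex.double_d S.f down_nat_rel_one_zero one_ne_zero]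
        infer_instance
      · exact HomologicalComplex.double_d_eq_zero₀ S.f down_nat_rel_one_zero _ _ (by simp)
    | n + 2 =>
      rw [quasiIsoAt_iff_exactAt' (hL := ChainComplex.exactAt_succ_single_obj ..)]
      exact ShortComplex.exact_of_isZero_X₂ _
        (HomologicalComplex.isZero_double_X S.f down_nat_rel_one_zero _ (by simp) (by simp))⟩

/-- The first left derived functor of `F` vanishes on `S.X₃` if `F` preserves the injectivity
of the first map of a two-term projective resolution `S`. -/
theorem CategoryTheory.ShortComplex.ShortExact.isZero_leftDerived_one
    {D : Type*} [Category* D] [Abelian D] [HasProjectiveResolutions C] (F : C ⥤ D) [F.Additive]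
    {S : ShortComplex C} (hS : S.ShortExact) [Projective S.X₁] [Projective S.X₂]
    [Mono (F.map S.f)] : IsZero ((F.leftDerived 1).obj S.X₃) := by
  refine IsZero.of_iso ?_ (hS.projectiveResolution.isoLeftDerivedObj F 1)
  erw [← HomologicalComplex.exactAt_iff_isZero_homology]
  rw [HomologicalComplex.exactAt_iff' _ 2 1 0 (by simp) (by simp), ShortComplex.exact_iff_mono]
  · change Mono (F.map ((HomologicalComplex.double S.f down_nat_rel_one_zero).d 1 0))
    rw [HomologicalComplex.double_d S.f down_nat_rel_one_zero one_ne_zero,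
      F.map_comp, F.map_comp]
    infer_instance
  · change F.map ((HomologicalComplex.double S.f down_nat_rel_one_zero).d 2 1) = 0
    rw [HomologicalComplex.double_d_eq_zero₀ _ _ _ _ (by simp), F.map_zero]

/-- `Tor₁(M, R/(f)) = 0` if `f` is regular on `R` and on `M`. -/
theorem isZero_tor_one_quotient_span_singleton {R : Type u} [CommRing R] {f : R}
    (hf : f ∈ nonZeroDivisors R) (M : Type u) [AddCommGroup M] [Module R M]
    (hM : IsSMulRegular M f) :
    IsZero (((Tor (ModuleCat.{u} R) 1).obj (ModuleCat.of R M)).obj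
      (ModuleCat.of R (R ⧸ Ideal.span {f}))) := by
  have hS : (ShortComplex.mk (ModuleCat.ofHom (LinearMap.lsmul R R f))
      (ModuleCat.ofHom (Ideal.span {f}).mkQ) (by
        ext
        simp)).ShortExact := by
    refine ShortComplex.ShortExact.mk' ?_ ?_ ?_
    · rw [ShortComplex.moduleCat_exact_iff]
      intro x hx
      obtain ⟨a, rfl⟩ := Ideal.mem_span_singleton'.1 ((Submodule.Quotient.mk_eq_zero _).1 hx)
      exact ⟨a, mul_comm f a⟩
    · rw [ModuleCat.mono_iff_injective]
      exact fun a b h => (mul_cancel_left_mem_nonZeroDivisors hf).1 h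
    · rw [ModuleCat.epi_iff_surjective]
      exact Submodule.mkQ_surjective _
  have : Projective (ModuleCat.of R R) :=
    ModuleCat.projective_of_free (Module.Basis.singleton Unit R)
  have : Mono (((MonoidalCategory.tensoringLeft (ModuleCat.{u} R)).obj (ModuleCat.of R M)).map
      (ModuleCat.ofHom (LinearMap.lsmul R R f))) := by
    rw [ModuleCat.mono_iff_injective]
    change Function.Injective ((LinearMap.lsmul R R f).lTensor M)
    have h : TensorProduct.rid R M ∘ₗ (LinearMap.lsmul R R f).lTensor M =
        LinearMap.lsmul R M f ∘ₗ TensorProduct.rid R M := by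
      ext
      simp
    refine Function.Injective.of_comp (f := TensorProduct.rid R M) ?_
    have := congrArg DFunLike.coe h
    simp only [LinearMap.coe_comp] at this
    erw [this]
    exact hM.comp (TensorProduct.rid R M).injective
  exact hS.isZero_leftDerived_one _

end Tor

section Alternating

variable {R N M P ι : Type*} [CommRing R] [AddCommGroup N] [Module R N] [AddCommGroup M]
  [Module R M] [AddCommGroup P] [Module R P]

/-- A multilinear map vanishing as soon as one argument lies in the kernel of `g` depends only on
the images of its arguments under `g`. -/
theorem MultilinearMap.eq_of_comp_eq [Finite ι] (A : MultilinearMap R (fun _ : ι => N) P)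
    (g : N →ₗ[R] M) (hA : ∀ v i, g (v i) = 0 → A v = 0) {v w : ι → N}
    (h : ∀ i, g (v i) = g (w i)) : A v = A w := by
  classical
  have := Fintype.ofFinite ι
  have key : A ((v - w) + w) = A w := by
    rw [A.map_add_univ, Finset.sum_eq_single ∅]
    · simp
    · intro s _ hs
      obtain ⟨i, hi⟩ := Finset.nonempty_iff_ne_empty.2 hs
      exact hA _ i (by simp [hi, h])
    · simp
  simpa using key

/-- An alternating map vanishing as soon as one argument lies in the kernel of a surjection `g`
descends along `g`, and is linear over any quotient of the base ring acting on source and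
target. -/
theorem AlternatingMap.exists_comp_eq_of_surjective {S : Type*} [CommRing S] [Algebra R S]
    [Module S M] [IsScalarTower R S M] [Module S P] [IsScalarTower R S P] [Finite ι]
    (hS : Function.Surjective (algebraMap R S)) (A : N [⋀^ι]→ₗ[R] P) (g : N →ₗ[R] M)
    (hg : Function.Surjective g) (hA : ∀ v i, g (v i) = 0 → A v = 0) :
    ∃ A' : M [⋀^ι]→ₗ[S] P, ∀ v : ι → N, A' (fun i => g (v i)) = A v := by
  have hs := Function.surjInv_eq hg
  have key : ∀ {v w : ι → N}, (∀ i, g (v i) = g (w i)) → A v = A w := fun h =>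
    A.toMultilinearMap.eq_of_comp_eq g hA h
  have e [DecidableEq ι] (m : ι → M) (i : ι) (n : N) :
      A (fun j => Function.surjInv hg (Function.update m i (g n) j)) =
        A (Function.update (fun j => Function.surjInv hg (m j)) i n) := by
    refine key fun j => ?_
    by_cases hj : j = i
    · subst hj; simp [hs]
    · simp [hs, hj]
  refine ⟨{
    toFun := fun m => A (fun i => Function.surjInv hg (m i))
    map_update_add' := fun m i x y => ?_
    map_update_smul' := fun m i c x => ?_
    map_eq_zero_of_eq' := fun v i j h hij => A.map_eq_zero_of_eq _ (by simp [h]) hij },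
    fun v => key fun i => hs _⟩
  · obtain ⟨x, rfl⟩ := hg x
    obtain ⟨y, rfl⟩ := hg y
    rw [← map_add, e, e, e, A.map_update_add]
  · obtain ⟨c, rfl⟩ := hS c
    obtain ⟨x, rfl⟩ := hg x
    rw [algebraMap_smul, algebraMap_smul, ← map_smul, e, e, A.map_update_smul]

end Alternating

section Quotient

variable {R : Type*} [CommRing R] {M : Type*} [AddCommGroup M] [Module R M] {f : R}

theorem TensorProduct.exists_eq_one_tmul_quotient (I : Ideal R) (x : (R ⧸ I) ⊗[R] M) :
    ∃ m : M, x = 1 ⊗ₜ m := by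
  obtain ⟨m, hm⟩ := Submodule.Quotient.mk_surjective _ (TensorProduct.quotTensorEquivQuotSMul M I x)
  refine ⟨m, ?_⟩
  rw [← TensorProduct.quotTensorEquivQuotSMul_symm_mk, hm, LinearEquiv.symm_apply_apply]

theorem TensorProduct.one_tmul_eq_zero_iff_of_span_singleton {m : M} :
    (1 : R ⧸ Ideal.span {f}) ⊗ₜ[R] m = 0 ↔ ∃ n, m = f • n := by
  rw [← (TensorProduct.quotTensorEquivQuotSMul M (Ideal.span {f})).map_eq_zero_iff,
    TensorProduct.quotTensorEquivQuotSMul_mk_one_tmul, Submodule.Quotient.mk_eq_zero,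
    Submodule.ideal_span_singleton_smul, Submodule.mem_smul_pointwise_iff_exists]
  simp [eq_comm]

theorem smul_eq_zero_of_quotient_span_singleton (f : R) [Module (R ⧸ Ideal.span {f}) M]
    [IsScalarTower R (R ⧸ Ideal.span {f}) M] (x : M) : f • x = 0 := by
  rw [← algebraMap_smul (R ⧸ Ideal.span {f}) f x, Ideal.Quotient.algebraMap_eq,
    Ideal.Quotient.eq_zero_iff_mem.2 (Ideal.mem_span_singleton_self f), zero_smul]

variable {k : Type*} [CommRing k] [Algebra k R]

/-- The kernel of `Ω_R → Ω_{R/(f)}` is generated by `df` and `f • Ω_R`. -/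
theorem KaehlerDifferential.exists_of_map_quotient_span_singleton_eq_zero {x : Ω[R⁄k]}
    (hx : KaehlerDifferential.map k k R (R ⧸ Ideal.span {f}) x = 0) :
    ∃ (a : R) (z : Ω[R⁄k]), x = a • KaehlerDifferential.D k R f + f • z := by
  have h1 : KaehlerDifferential.mapBaseChange k R (R ⧸ Ideal.span {f}) (1 ⊗ₜ x) = 0 := by
    simp [hx]
  obtain ⟨y, hy⟩ := (KaehlerDifferential.exact_kerCotangentToTensor_mapBaseChange k R
    (R ⧸ Ideal.span {f}) Ideal.Quotient.mk_surjective _).1 h1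
  obtain ⟨⟨g, hg⟩, rfl⟩ := Ideal.toCotangent_surjective _ y
  have hg' := hg
  rw [RingHom.mem_ker, Ideal.Quotient.algebraMap_eq, Ideal.Quotient.eq_zero_iff_mem,
    Ideal.mem_span_singleton'] at hg'
  obtain ⟨a, rfl⟩ := hg'
  rw [KaehlerDifferential.kerCotangentToTensor_toCotangent] at hy
  obtain ⟨z, hz⟩ := TensorProduct.one_tmul_eq_zero_iff_of_span_singleton.1
    (show (1 : R ⧸ Ideal.span {f}) ⊗ₜ[R] (x - KaehlerDifferential.D k R (a * f)) = 0 by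
      rw [TensorProduct.tmul_sub, ← hy, sub_self])
  refine ⟨a, KaehlerDifferential.D k R a + z, ?_⟩
  rw [sub_eq_iff_eq_add.1 hz, Derivation.leibniz, smul_add]
  abel

end Quotient

section Reduction

open KaehlerDifferential

namespace Stmt9

variable (B : Type u) [CommRing B] [Algebra ℂ B] (f : B)

theorem wedgeD_ιMulti (q : ℕ) (v : Fin q → Ω[B⁄ℂ]) :
    wedgeD B f q (exteriorPower.ιMulti B q v) =
      exteriorPower.ιMulti B (q + 1) (Fin.cons (D ℂ B f) v) := by
  ext
  simp [wedgeD, ExteriorAlgebra.ιMulti_succ_apply, Matrix.vecTail, Function.comp_def]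

theorem wedgeD_wedgeD (q : ℕ) (x : ⋀[B]^q Ω[B⁄ℂ]) : wedgeD B f (q + 1) (wedgeD B f q x) = 0 := by
  ext
  simp [wedgeD, ← mul_assoc]

/-- Reduction of differential forms modulo `f`. -/
noncomputable def reduction (q : ℕ) : ⋀[B]^q Ω[B⁄ℂ] →ₗ[B] ⋀[Bbar B f]^q Ω[Bbar B f⁄ℂ] :=
  exteriorPower.alternatingMapLinearEquiv
    (AlternatingMap.compLinearMap
      { (exteriorPower.ιMulti (Bbar B f) q).toMultilinearMap.restrictScalars B with
        map_eq_zero_of_eq' := (exteriorPower.ιMulti (Bbar B f) q).map_eq_zero_of_eq' }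
      (KaehlerDifferential.map ℂ ℂ B (Bbar B f)))

@[simp]
theorem reduction_ιMulti (q : ℕ) (v : Fin q → Ω[B⁄ℂ]) :
    reduction B f q (exteriorPower.ιMulti B q v) =
      exteriorPower.ιMulti (Bbar B f) q
        (fun i => KaehlerDifferential.map ℂ ℂ B (Bbar B f) (v i)) := by
  rw [reduction, exteriorPower.alternatingMapLinearEquiv_apply_ιMulti]
  rfl

theorem map_D_self : KaehlerDifferential.map ℂ ℂ B (Bbar B f) (D ℂ B f) = 0 := by
  rw [KaehlerDifferential.map_D, Ideal.Quotient.algebraMap_eq,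
    Ideal.Quotient.eq_zero_iff_mem.2 (Ideal.mem_span_singleton_self f), map_zero]

theorem map_surjective : Function.Surjective (KaehlerDifferential.map ℂ ℂ B (Bbar B f)) :=
  KaehlerDifferential.map_surjective_of_surjective ℂ ℂ B _ Ideal.Quotient.mk_surjective

theorem reduction_wedgeD (q : ℕ) (x : ⋀[B]^q Ω[B⁄ℂ]) :
    reduction B f (q + 1) (wedgeD B f q x) = 0 := by
  suffices h : reduction B f (q + 1) ∘ₗ wedgeD B f q = 0 from LinearMap.congr_fun h x
  refine exteriorPower.linearMap_ext (AlternatingMap.ext fun v => ?_)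
  simp only [LinearMap.compAlternatingMap_apply, LinearMap.comp_apply, wedgeD_ιMulti,
    reduction_ιMulti, LinearMap.zero_apply]
  exact AlternatingMap.map_coord_zero _ 0 (map_D_self B f)

variable {B f} in
/-- An alternating map on `Ω_B` with values in a `B/(f)`-module that kills `df` factors through
the forms on `B/(f)`. -/
theorem exists_lift_reduction {q : ℕ} {P : Type*} [AddCommGroup P] [Module B P]
    [Module (Bbar B f) P] [IsScalarTower B (Bbar B f) P] (A : ⋀[B]^q Ω[B⁄ℂ] →ₗ[B] P)
    (hA : ∀ (v : Fin q → Ω[B⁄ℂ]) (i : Fin q), v i = D ℂ B f →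
      A (exteriorPower.ιMulti B q v) = 0) :
    ∃ L : ⋀[Bbar B f]^q Ω[Bbar B f⁄ℂ] →ₗ[Bbar B f] P, ∀ x, L (reduction B f q x) = A x := by
  obtain ⟨A', hA'⟩ := (A.compAlternatingMap
    (exteriorPower.ιMulti B q)).exists_comp_eq_of_surjective (S := Bbar B f)
    Ideal.Quotient.mk_surjective (KaehlerDifferential.map ℂ ℂ B (Bbar B f)) (map_surjective B f)
    (fun v i hv => by
      obtain ⟨a, z, h⟩ := exists_of_map_quotient_span_singleton_eq_zero hv
      rw [← Function.update_eq_self i v, h, AlternatingMap.map_update_add,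
        AlternatingMap.map_update_smul, AlternatingMap.map_update_smul,
        smul_eq_zero_of_quotient_span_singleton f, add_zero, LinearMap.compAlternatingMap_apply,
        hA _ i (Function.update_self ..), smul_zero])
  refine ⟨exteriorPower.alternatingMapLinearEquiv A', fun x => ?_⟩
  suffices h : (exteriorPower.alternatingMapLinearEquiv A').restrictScalars B ∘ₗ
      reduction B f q = A from LinearMap.congr_fun h x
  refine exteriorPower.linearMap_ext (AlternatingMap.ext fun v => ?_)
  simpa using hA' v

/-- The canonical map `B/(f) ⊗ Ω^q_B → Ω^q_{B/(f)}`. -/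
noncomputable def restriction (q : ℕ) :
    Bbar B f ⊗[B] ⋀[B]^q Ω[B⁄ℂ] →ₗ[Bbar B f] ⋀[Bbar B f]^q Ω[Bbar B f⁄ℂ] :=
  (reduction B f q).liftBaseChange (Bbar B f)

@[simp]
theorem restriction_one_tmul (q : ℕ) (x : ⋀[B]^q Ω[B⁄ℂ]) :
    restriction B f q (1 ⊗ₜ x) = reduction B f q x := by
  simp [restriction]

theorem restriction_surjective (q : ℕ) : Function.Surjective (restriction B f q) := by
  rw [← LinearMap.range_eq_top, eq_top_iff, ← exteriorPower.ιMulti_span, Submodule.span_le]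
  rintro _ ⟨m, rfl⟩
  choose v hv using fun i => map_surjective B f (m i)
  exact ⟨1 ⊗ₜ exteriorPower.ιMulti B q v, by simp [hv]⟩

theorem reduction_surjective (q : ℕ) : Function.Surjective (reduction B f q) := fun y => by
  obtain ⟨x, rfl⟩ := restriction_surjective B f q y
  obtain ⟨w, rfl⟩ := TensorProduct.exists_eq_one_tmul_quotient _ x
  exact ⟨w, (restriction_one_tmul B f q w).symm⟩

/-- Lifting a form on `B/(f)` to `B` and wedging with `df`. -/
theorem exists_liftWedge (q : ℕ) :
    ∃ φ : ⋀[Bbar B f]^q Ω[Bbar B f⁄ℂ] →ₗ[Bbar B f] Bbar B f ⊗[B] ⋀[B]^(q + 1) Ω[B⁄ℂ],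
      ∀ x, φ (reduction B f q x) = 1 ⊗ₜ wedgeD B f q x := by
  refine exists_lift_reduction (TensorProduct.mk B (Bbar B f) _ 1 ∘ₗ wedgeD B f q)
    fun v i hv => ?_
  rw [LinearMap.comp_apply, wedgeD_ιMulti,
    AlternatingMap.map_eq_zero_of_eq _ _ (i := 0) (j := i.succ) (by simp [hv])
      (Fin.succ_ne_zero i).symm, map_zero]

variable {B f} in
/-- A product of one-forms with a factor `df` is a multiple of `df`. -/
theorem ιMulti_mem_range_wedgeD {q : ℕ} {v : Fin (q + 1) → Ω[B⁄ℂ]} {i : Fin (q + 1)}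
    (hv : v i = D ℂ B f) :
    exteriorPower.ιMulti B (q + 1) v ∈ LinearMap.range (wedgeD B f q) := by
  have h0 : ∀ w : Fin (q + 1) → Ω[B⁄ℂ], w 0 = D ℂ B f →
      exteriorPower.ιMulti B (q + 1) w ∈ LinearMap.range (wedgeD B f q) := fun w hw =>
    ⟨exteriorPower.ιMulti B q (Fin.tail w), by rw [wedgeD_ιMulti, ← hw, Fin.cons_self_tail]⟩
  have h := h0 (v ∘ Equiv.swap 0 i) (by simp [hv])
  rw [AlternatingMap.map_perm] at h
  rcases Int.units_eq_one_or (Equiv.Perm.sign (Equiv.swap 0 i)) with hs | hs <;>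
    simpa [hs] using h

variable {B f} in
theorem exact_liftWedge_restriction {q : ℕ}
    {φ : ⋀[Bbar B f]^q Ω[Bbar B f⁄ℂ] →ₗ[Bbar B f] Bbar B f ⊗[B] ⋀[B]^(q + 1) Ω[B⁄ℂ]}
    (hφ : ∀ x, φ (reduction B f q x) = 1 ⊗ₜ wedgeD B f q x) :
    Function.Exact φ (restriction B f (q + 1)) := by
  intro x
  constructor
  · intro hx
    obtain ⟨w, rfl⟩ := TensorProduct.exists_eq_one_tmul_quotient _ x
    obtain ⟨L, hL⟩ := exists_lift_reduction (f := f)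
      ((LinearMap.range φ).mkQ.restrictScalars B ∘ₗ TensorProduct.mk B (Bbar B f) _ 1)
      (fun v i hv => by
        obtain ⟨y, hy⟩ := ιMulti_mem_range_wedgeD hv
        rw [← hy]
        exact (Submodule.Quotient.mk_eq_zero _).2 ⟨reduction B f q y, hφ y⟩)
    have h := hL w
    rw [← restriction_one_tmul, hx, map_zero] at h
    exact (Submodule.Quotient.mk_eq_zero _).1 h.symm
  · rintro ⟨y, rfl⟩
    obtain ⟨w, rfl⟩ := reduction_surjective B f q y
    rw [hφ, restriction_one_tmul, reduction_wedgeD]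

end Stmt9

end Reduction

theorem statement9 (B : Type u) [CommRing B] [Algebra ℂ B] (f : B)
    (hf : f ∈ nonZeroDivisors B) (k : ℕ) (hk : 1 ≤ k)
    -- (a) the de Rham lemma: injectivity of `Ω^{p−1}/(df ∧ Ω^{p−2}) → Ω^p` for `1 ≤ p ≤ k+1`
    (ha0 : ∀ x : ↥(⋀[B]^0 (Ω[B⁄ℂ])), Stmt9.wedgeD B f 0 x = 0 → x = 0)
    (ha : ∀ q : ℕ, q + 1 ≤ k → ∀ x : ↥(⋀[B]^(q + 1) (Ω[B⁄ℂ])),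
      Stmt9.wedgeD B f (q + 1) x = 0 → ∃ y, Stmt9.wedgeD B f q y = x)
    -- (b) no `f`-torsion on `Ω^p_B` for `2 ≤ p ≤ k+1`
    (hb : ∀ p : ℕ, 2 ≤ p → p ≤ k + 1 → ∀ x : ↥(⋀[B]^p (Ω[B⁄ℂ])), f • x = 0 → x = 0) :
    ∀ q : ℕ, q + 1 ≤ k →
      -- `Tor₁^B(Ω^{q+1}_B/(df ∧ Ω^q_B), B̄) = 0`
      (CategoryTheory.Limits.IsZero
        (((CategoryTheory.Tor (ModuleCat.{u} B) 1).obj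
            (ModuleCat.of B
              (↥(⋀[B]^(q + 1) (Ω[B⁄ℂ])) ⧸ LinearMap.range (Stmt9.wedgeD B f q)))).obj
          (ModuleCat.of B (Stmt9.Bbar B f)))) ∧
      -- the exact sequence `0 → Ω^q_{B̄} → B̄ ⊗_B Ω^{q+1}_B → Ω^{q+1}_{B̄} → 0`
      (∃ (φ : ↥(⋀[Stmt9.Bbar B f]^q (Ω[Stmt9.Bbar B f⁄ℂ])) →ₗ[Stmt9.Bbar B f]
              (Stmt9.Bbar B f ⊗[B] ↥(⋀[B]^(q + 1) (Ω[B⁄ℂ]))))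
          (ψ : (Stmt9.Bbar B f ⊗[B] ↥(⋀[B]^(q + 1) (Ω[B⁄ℂ]))) →ₗ[Stmt9.Bbar B f]
              ↥(⋀[Stmt9.Bbar B f]^(q + 1) (Ω[Stmt9.Bbar B f⁄ℂ]))),
        -- `φ` is induced by lifting a form to `B` and wedging with `df`:
        (∀ (b : Fin q → B)
            (h₁ : ExteriorAlgebra.ιMulti (Stmt9.Bbar B f) q
                (fun i => KaehlerDifferential.D ℂ (Stmt9.Bbar B f)
                  (Ideal.Quotient.mk (Ideal.span {f}) (b i))) ∈
              ⋀[Stmt9.Bbar B f]^q (Ω[Stmt9.Bbar B f⁄ℂ]))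
            (h₂ : ExteriorAlgebra.ιMulti B (q + 1)
                (Fin.cons (KaehlerDifferential.D ℂ B f)
                  (fun i => KaehlerDifferential.D ℂ B (b i))) ∈
              ⋀[B]^(q + 1) (Ω[B⁄ℂ])),
          φ ⟨_, h₁⟩ = (1 : Stmt9.Bbar B f) ⊗ₜ[B] ⟨_, h₂⟩) ∧
        -- `ψ` is the canonical surjection:
        (∀ (b : Fin (q + 1) → B)
            (h₁ : ExteriorAlgebra.ιMulti B (q + 1)
                (fun i => KaehlerDifferential.D ℂ B (b i)) ∈ ⋀[B]^(q + 1) (Ω[B⁄ℂ]))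
            (h₂ : ExteriorAlgebra.ιMulti (Stmt9.Bbar B f) (q + 1)
                (fun i => KaehlerDifferential.D ℂ (Stmt9.Bbar B f)
                  (Ideal.Quotient.mk (Ideal.span {f}) (b i))) ∈
              ⋀[Stmt9.Bbar B f]^(q + 1) (Ω[Stmt9.Bbar B f⁄ℂ])),
          ψ ((1 : Stmt9.Bbar B f) ⊗ₜ[B] ⟨_, h₁⟩) = ⟨_, h₂⟩) ∧
        Function.Injective φ ∧ Function.Surjective ψ ∧ Function.Exact φ ψ) := by
  intro q hq
  have hmem : ∀ x : ⋀[B]^(q + 1) (Ω[B⁄ℂ]), f • x ∈ LinearMap.range (Stmt9.wedgeD B f q) →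
      x ∈ LinearMap.range (Stmt9.wedgeD B f q) := by
    rintro x ⟨y, hy⟩
    refine ha q hq x (hb (q + 2) (by omega) (by omega) _ ?_)
    rw [← map_smul, ← hy, Stmt9.wedgeD_wedgeD]
  obtain ⟨φ, hφ⟩ := Stmt9.exists_liftWedge B f q
  refine ⟨isZero_tor_one_quotient_span_singleton hf _ ?_, φ, Stmt9.restriction B f (q + 1),
    fun b h₁ h₂ => ?_, fun b h₁ h₂ => ?_, ?_, Stmt9.restriction_surjective B f (q + 1),
    Stmt9.exact_liftWedge_restriction hφ⟩
  · rw [isSMulRegular_iff_right_eq_zero_of_smul]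
    intro x hx
    obtain ⟨x, rfl⟩ := Submodule.Quotient.mk_surjective _ x
    rw [← Submodule.Quotient.mk_smul, Submodule.Quotient.mk_eq_zero] at hx
    exact (Submodule.Quotient.mk_eq_zero _).2 (hmem x hx)
  · convert hφ (exteriorPower.ιMulti B q fun i => KaehlerDifferential.D ℂ B (b i)) using 2
    · ext
      simp
    · rw [Stmt9.wedgeD_ιMulti]
      rfl
  · refine (Stmt9.restriction_one_tmul B f (q + 1)
      (exteriorPower.ιMulti B (q + 1) fun i => KaehlerDifferential.D ℂ B (b i))).trans ?_
    ext
    simp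
  · rw [injective_iff_map_eq_zero]
    intro y hy
    obtain ⟨w, rfl⟩ := Stmt9.reduction_surjective B f q y
    rw [hφ, TensorProduct.one_tmul_eq_zero_iff_of_span_singleton] at hy
    obtain ⟨η, hη⟩ := hy
    obtain ⟨ξ, rfl⟩ := hmem η ⟨w, hη⟩
    have hw : Stmt9.wedgeD B f q (w - f • ξ) = 0 := by rw [map_sub, map_smul, hη, sub_self]
    have hred : Stmt9.reduction B f q (w - f • ξ) = Stmt9.reduction B f q w := by
      rw [map_sub, ← Stmt9.restriction_one_tmul B f q (f • ξ),
        TensorProduct.one_tmul_eq_zero_iff_of_span_singleton.2 ⟨ξ, rfl⟩, map_zero, sub_zero]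
    rw [← hred]
    cases q with
    | zero => rw [ha0 _ hw, map_zero]
    | succ q =>
      obtain ⟨ζ, hζ⟩ := ha q (by omega) _ hw
      rw [← hζ, Stmt9.reduction_wedgeD]
end

section
/- Fix i ∈ ℕ and let h : ℕ × ℕ → ℕ satisfy h(r,s) = h(s,r) for all r, s, and h(r,s) = 0 whenever r + s > i. Define h̄(p,q) := Σ_{r=0}^{q} h(p,r). Then for every 0 ≤ p ≤ i one has Σ_{a=0}^{p} h̄(i−a, a) ≤ Σ_{a=0}^{p} h̄(a, i−a). Moreover, for every 0 ≤ k ≤ i the following are equivalent: (1) Σ_{a=0}^{p} h̄(i−a, a) = Σ_{a=0}^{p} h̄(a, i−a) for all p ≤ k; (2) h̄(p, i−p) = h̄(i−p, p) for all p ≤ k; (3) h(r,s) = 0 for all r ≤ k and r + s ≤ i − 1. -/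
/-!
Statement 10: Fix `i ∈ ℕ` and let `h : ℕ × ℕ → ℕ` be symmetric with `h r s = 0`
whenever `r + s > i`.  Define `h̄ p q := ∑_{r=0}^{q} h p r`.  Then for every `0 ≤ p ≤ i`,
`∑_{a=0}^{p} h̄ (i−a) a ≤ ∑_{a=0}^{p} h̄ a (i−a)`, and for every `0 ≤ k ≤ i` the three
conditions (1) equality of the partial sums for all `p ≤ k`, (2) `h̄ p (i−p) = h̄ (i−p) p`
for all `p ≤ k`, (3) `h r s = 0` for all `r ≤ k` and `r + s ≤ i − 1`, are equivalent.
(The condition `r + s ≤ i - 1` is rendered as `r + s + 1 ≤ i`.)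
-/

/-- The "Hodge–Du Bois numbers" `h̄ p q = ∑_{r=0}^{q} h p r` associated to
the "Hodge–Deligne numbers" `h`. -/
def hbar (h : ℕ → ℕ → ℕ) (p q : ℕ) : ℕ := ∑ r ∈ Finset.range (q + 1), h p r

/-- Extending the summation range of `hbar` does not change it once the extra terms vanish. -/
theorem hbar_eq_sum_range {i : ℕ} {h : ℕ → ℕ → ℕ}
    (hvanish : ∀ r s, i < r + s → h r s = 0) {p q m : ℕ} (hpq : i ≤ p + q) (hqm : q ≤ m) :
    hbar h p q = ∑ r ∈ Finset.range (m + 1), h p r := by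
  refine Finset.sum_subset (Finset.range_mono (by omega)) fun r _ hr => hvanish _ _ ?_
  rw [Finset.mem_range] at hr
  omega

/-- The partial sums of `hbar` differ by the sum of `h` over a rectangle below the antidiagonal. -/
theorem sum_hbar_eq_add_sum_rectangle {i : ℕ} {h : ℕ → ℕ → ℕ}
    (hsymm : ∀ r s, h r s = h s r) (hvanish : ∀ r s, i < r + s → h r s = 0)
    {p : ℕ} (hp : p ≤ i) :
    ∑ a ∈ Finset.range (p + 1), hbar h a (i - a) =
      ∑ r ∈ Finset.range (p + 1), ∑ s ∈ Finset.range (i - p), h r s +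
        ∑ a ∈ Finset.range (p + 1), hbar h (i - a) a := by
  have row : ∀ a ∈ Finset.range (p + 1), hbar h a (i - a) =
      ∑ s ∈ Finset.range (i - p), h a s + ∑ s ∈ Finset.range (p + 1), h a (i - s) := by
    intro a ha
    rw [hbar_eq_sum_range hvanish (m := i) (by omega) (by omega),
      show i + 1 = (i - p) + (p + 1) by omega, Finset.sum_range_add,
      ← Finset.sum_range_reflect (fun s => h a (i - p + s))]
    congr 1
    refine Finset.sum_congr rfl fun s hs => ?_
    rw [Finset.mem_range] at hs
    congr 1
    omega
  have col : ∀ a ∈ Finset.range (p + 1), hbar h (i - a) a =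
      ∑ r ∈ Finset.range (p + 1), h r (i - a) := by
    intro a ha
    rw [Finset.mem_range] at ha
    rw [hbar_eq_sum_range hvanish (m := p) (by omega) (by omega)]
    exact Finset.sum_congr rfl fun r _ => hsymm _ _
  rw [Finset.sum_congr rfl row, Finset.sum_congr rfl col, Finset.sum_add_distrib]
  congr 1
  exact Finset.sum_comm

/-- Two sequences have equal partial sums up to `k` iff they agree up to `k`. -/
theorem forall_sum_range_succ_eq_iff {M : Type*} [AddCancelCommMonoid M] (f g : ℕ → M) (k : ℕ) :
    (∀ p, p ≤ k → ∑ a ∈ Finset.range (p + 1), f a = ∑ a ∈ Finset.range (p + 1), g a) ↔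
      ∀ p, p ≤ k → g p = f p := by
  constructor
  · intro H p hp
    have hsum := H p hp
    cases p with
    | zero => simpa using hsum.symm
    | succ p =>
      rw [Finset.sum_range_succ, Finset.sum_range_succ _ (p + 1), H p (by omega)] at hsum
      exact (add_left_cancel hsum).symm
  · intro H p hp
    refine Finset.sum_congr rfl fun a ha => (H a ?_).symm
    rw [Finset.mem_range] at ha
    omega

theorem statement10 (i : ℕ) (h : ℕ → ℕ → ℕ)
    (hsymm : ∀ r s, h r s = h s r)
    (hvanish : ∀ r s, i < r + s → h r s = 0) :
    (∀ p, p ≤ i →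
      ∑ a ∈ Finset.range (p + 1), hbar h (i - a) a ≤
        ∑ a ∈ Finset.range (p + 1), hbar h a (i - a)) ∧
    (∀ k, k ≤ i →
      (((∀ p, p ≤ k →
            ∑ a ∈ Finset.range (p + 1), hbar h (i - a) a =
              ∑ a ∈ Finset.range (p + 1), hbar h a (i - a)) ↔
          (∀ p, p ≤ k → hbar h p (i - p) = hbar h (i - p) p)) ∧
        ((∀ p, p ≤ k → hbar h p (i - p) = hbar h (i - p) p) ↔
          (∀ r s, r ≤ k → r + s + 1 ≤ i → h r s = 0)))) := by
  have key := fun p (hp : p ≤ i) => sum_hbar_eq_add_sum_rectangle hsymm hvanish hp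
  refine ⟨fun p hp => by rw [key p hp]; exact Nat.le_add_left _ _, fun k hk => ?_⟩
  have h12 := forall_sum_range_succ_eq_iff (fun a => hbar h (i - a) a)
    (fun a => hbar h a (i - a)) k
  refine ⟨h12, h12.symm.trans ⟨fun H r s hr hrs => ?_, fun H p hp => ?_⟩⟩
  · have hsum : ∑ a ∈ Finset.range (r + 1), ∑ b ∈ Finset.range (i - r), h a b = 0 := by
      have h1 := H r hr
      have h2 := key r (by omega)
      omega
    simp only [Finset.sum_eq_zero_iff, Finset.mem_range] at hsum
    exact hsum r (by omega) s (by omega)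
  · rw [key p (by omega), eq_comm, add_eq_right]
    refine Finset.sum_eq_zero fun r hr => ?_
    refine Finset.sum_eq_zero fun s hs => ?_
    rw [Finset.mem_range] at hr hs
    exact H r s (by omega) (by omega)
end
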